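/- Let m ≥ 3, let K ⊂ ℝ^m be a compact set whose complement is connected, let ω be a continuity modulus, and let f ∈ C^ω(K). Then there exist a constant c > 0 and a function f₀ : ℝ^m → ℝ, continuous with compact support and infinitely differentiable on ℝ^m ∖ K, such that f₀ = f on K, |f₀(X₁) − f₀(X₂)| ≤ c ω(|X₁ − X₂|) for all X₁, X₂ ∈ ℝ^m, and |∇f₀(X)| ≤ c ω(d(X))/d(X) for all X ∉ K. -/

import Mathlib

open MeasureTheory Metric Set Filter

noncomputable section

/-- A continuity modulus: a positive, nondecreasing, concave function on `(0,∞)`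
tending to `0` at `0⁺`, with `t ↦ ω t / t` nonincreasing. -/
def IsContinuityModulus (ω : ℝ → ℝ) : Prop :=
  (∀ t : ℝ, 0 < t → 0 < ω t) ∧
  (∀ s t : ℝ, 0 < s → s ≤ t → ω s ≤ ω t) ∧
  ConcaveOn ℝ (Set.Ioi (0:ℝ)) ω ∧
  Filter.Tendsto ω (nhdsWithin 0 (Set.Ioi (0:ℝ))) (nhds 0) ∧
  (∀ s t : ℝ, 0 < s → s ≤ t → ω t / t ≤ ω s / s)

/-- Condition A of the paper: for each `δ > 0` there is a finite `δ`-separated subset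
`Z δ` of `K` whose `c₀ δ`-closed balls cover the `δ`-neighborhood of `K`, with the number
of points of `Z δ` in any ball of radius `R ≥ δ` bounded by `c₁ (R/δ)^{m-2}`. -/
def ConditionA (m : ℕ) (K : Set (EuclideanSpace ℝ (Fin m))) (c₀ c₁ : ℝ)
    (Z : ℝ → Finset (EuclideanSpace ℝ (Fin m))) : Prop :=
  0 < c₀ ∧ 0 < c₁ ∧
  ∀ δ : ℝ, 0 < δ →
    ((Z δ : Set (EuclideanSpace ℝ (Fin m))) ⊆ K) ∧
    (∀ x ∈ Z δ, ∀ y ∈ Z δ, x ≠ y → δ ≤ dist x y) ∧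
    (Metric.thickening δ K ⊆ ⋃ z ∈ Z δ, Metric.closedBall z (c₀ * δ)) ∧
    (∀ R : ℝ, δ ≤ R → ∀ X : EuclideanSpace ℝ (Fin m),
      (((Z δ : Set (EuclideanSpace ℝ (Fin m))) ∩ Metric.closedBall X R).ncard : ℝ)
        ≤ c₁ * (R / δ) ^ (m - 2))

lemma aux_mollify {E : Type*} [NormedAddCommGroup E] [NormedSpace ℝ E] [FiniteDimensional ℝ E]
    (g : E → ℝ) (L : ℝ) (hL : 0 ≤ L) (hg : ∀ x y, |g x - g y| ≤ L * dist x y)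
    (ε : ℝ) (hε : 0 < ε) :
    ∃ h : E → ℝ, ContDiff ℝ (⊤ : ℕ∞) h ∧ (∀ x y, |h x - h y| ≤ L * dist x y) ∧
      ∀ x, |h x - g x| ≤ ε := by
  borelize E
  have hLip : LipschitzWith L.toNNReal g := LipschitzWith.of_dist_le_mul (by
    intro x y; rw [Real.dist_eq, Real.coe_toNNReal _ hL]; exact hg x y)
  have hgc : Continuous g := hLip.continuous
  let μ : Measure E := .addHaar
  let r := ε / (L + 1)
  have hr : 0 < r := by positivity
  let φ : ContDiffBump (0 : E) := ⟨r / 2, r, half_pos hr, half_lt_self hr⟩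
  have hli := hgc.locallyIntegrable (μ := μ)
  refine ⟨MeasureTheory.convolution (φ.normed μ) g (ContinuousLinearMap.lsmul ℝ ℝ) μ, ?_, ?_, ?_⟩
  · exact φ.hasCompactSupport_normed.contDiff_convolution_left _ φ.contDiff_normed hli
  · intro x y
    have hex : ∀ x, MeasureTheory.ConvolutionExistsAt (φ.normed μ) g x
        (ContinuousLinearMap.lsmul ℝ ℝ) μ := fun x =>
      φ.hasCompactSupport_normed.convolutionExists_left _ φ.continuous_normed hli x
    have hx := hex x
    have hy := hex y
    unfold MeasureTheory.ConvolutionExistsAt at hx hy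
    unfold MeasureTheory.convolution
    rw [← integral_sub hx hy, ← Real.norm_eq_abs]
    have : ∫ t, φ.normed μ t * (L * dist x y) ∂μ = L * dist x y := by
      rw [integral_mul_const, φ.integral_normed, one_mul]
    rw [← this]
    refine norm_integral_le_of_norm_le (φ.integrable_normed.mul_const _) (.of_forall fun t => ?_)
    simp only [ContinuousLinearMap.lsmul_apply, smul_eq_mul]
    rw [← mul_sub, norm_mul, Real.norm_of_nonneg (φ.nonneg_normed t), Real.norm_eq_abs]
    refine mul_le_mul_of_nonneg_left ?_ (φ.nonneg_normed t)
    simpa using hg (x - t) (y - t)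
  · intro x
    rw [← Real.dist_eq]
    refine φ.dist_normed_convolution_le hgc.aestronglyMeasurable fun z hz => ?_
    rw [Real.dist_eq]
    have h1 : dist z x < r := hz
    calc _ ≤ L * dist z x := hg z x
      _ ≤ (L + 1) * r := by gcongr; linarith
      _ = ε := by simp only [r]; field_simp

lemma aux_theta {E : Type*} [NormedAddCommGroup E] [NormedSpace ℝ E] [FiniteDimensional ℝ E]
    (K : Set E) : ∃ B : ℝ, 0 ≤ B ∧ ∀ t : ℝ, 0 < t → ∃ θ : E → ℝ, ContDiff ℝ (⊤ : ℕ∞) θ ∧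
      (∀ x y, |θ x - θ y| ≤ B / t * dist x y) ∧ (∀ x, 0 ≤ θ x) ∧ (∀ x, θ x ≤ 1) ∧
      (∀ x, infDist x K ≤ 9 / 8 * t → θ x = 1) ∧ (∀ x, 15 / 8 * t ≤ infDist x K → θ x = 0) := by
  let η : ContDiffBump (0 : ℝ) := ⟨5/4, 7/4, by norm_num, by norm_num⟩
  obtain ⟨B, hB⟩ := ContDiff.lipschitzWith_of_hasCompactSupport η.hasCompactSupport
    (η.contDiff (n := 1)) (by norm_num)
  refine ⟨B, B.2, fun t ht => ?_⟩
  obtain ⟨h, hs, hl, ha⟩ := aux_mollify (fun x => infDist x K) 1 zero_le_one (by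
    intro x y
    simpa [Real.dist_eq] using (lipschitz_infDist_pt K).dist_le_mul x y) (t / 8) (by positivity)
  refine ⟨fun x => η (h x / t), ?_, ?_, fun x => η.nonneg, fun x => η.le_one, ?_, ?_⟩
  · exact η.contDiff.comp (hs.div_const t)
  · intro x y
    have h1 := hB.dist_le_mul (h x / t) (h y / t)
    rw [Real.dist_eq, Real.dist_eq, ← sub_div, abs_div, abs_of_pos ht] at h1
    calc _ ≤ _ := h1
      _ ≤ B * ((1 * dist x y) / t) := by gcongr; exact hl x y
      _ = _ := by ring
  · intro x hx
    apply η.one_of_mem_closedBall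
    have := abs_le.1 (ha x)
    have h0 := infDist_nonneg (x := x) (s := K)
    simp only [mem_closedBall, dist_zero_right, Real.norm_eq_abs, η]
    rw [abs_le]
    constructor
    · rw [le_div_iff₀ ht]; linarith
    · rw [div_le_iff₀ ht]; linarith
  · intro x hx
    apply η.zero_of_le_dist
    have := abs_le.1 (ha x)
    simp only [dist_zero_right, Real.norm_eq_abs, η]
    refine le_trans ?_ (le_abs_self _)
    rw [le_div_iff₀ ht]; linarith

lemma aux_approx {E : Type*} [NormedAddCommGroup E] [NormedSpace ℝ E] [FiniteDimensional ℝ E]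
    (K : Set E) (hne : K.Nonempty) (w : ℝ → ℝ) (f : E → ℝ) (Cf : ℝ) (hCf : 0 < Cf)
    (hpos : ∀ t : ℝ, 0 < t → 0 < w t) (hmono : ∀ s t : ℝ, 0 < s → s ≤ t → w s ≤ w t)
    (hrat : ∀ s t : ℝ, 0 < s → s ≤ t → w t / t ≤ w s / s)
    (hf : ∀ X ∈ K, ∀ Y ∈ K, X ≠ Y → |f X - f Y| ≤ Cf * w (dist X Y)) (t : ℝ) (ht : 0 < t) :
    ∃ g : E → ℝ, ContDiff ℝ (⊤ : ℕ∞) g ∧ (∀ x y, |g x - g y| ≤ Cf * w t / t * dist x y) ∧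
      ∀ x ∈ K, |g x - f x| ≤ 2 * Cf * w t := by
  have hwt := hpos t ht
  set L := Cf * w t / t with hLdef
  have hL : 0 < L := by positivity
  have key : ∀ X ∈ K, ∀ Y ∈ K, f X - Cf * w t ≤ f Y + L * dist X Y := by
    intro X hX Y hY
    rcases eq_or_ne X Y with rfl | hXY
    · simp; positivity
    have h1 := (abs_le.1 (hf X hX Y hY hXY)).2
    have hd : 0 < dist X Y := dist_pos.2 hXY
    rcases le_total (dist X Y) t with h | h
    · have := mul_le_mul_of_nonneg_left (hmono _ _ hd h) hCf.le
      have : 0 ≤ L * dist X Y := by positivity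
      linarith
    · have h2 := hrat _ _ ht h
      rw [div_le_iff₀ hd] at h2
      have h3 := mul_le_mul_of_nonneg_left h2 hCf.le
      have h4 : Cf * (w t / t * dist X Y) = L * dist X Y := by rw [hLdef]; ring
      have : 0 < Cf * w t := by positivity
      linarith
  have : Nonempty K := hne.to_subtype
  obtain ⟨Y0, hY0⟩ := hne
  have hbdd : ∀ x : E, BddBelow (range fun Y : K => f Y + L * dist x Y) := by
    intro x
    refine ⟨f Y0 - Cf * w t - L * dist Y0 x, ?_⟩
    rintro _ ⟨Y, rfl⟩
    have h1 := key Y0 hY0 Y Y.2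
    have h2 := mul_le_mul_of_nonneg_left (dist_triangle Y0 x Y) hL.le
    simp only
    linarith
  let F : E → ℝ := fun x => ⨅ Y : K, f Y + L * dist x Y
  have hF1 : ∀ x y, F x - F y ≤ L * dist x y := by
    intro x y
    have : F x - L * dist x y ≤ F y := by
      refine le_ciInf fun Y => ?_
      have h1 : F x ≤ f Y + L * dist x Y := ciInf_le (hbdd x) Y
      have h2 := mul_le_mul_of_nonneg_left (dist_triangle x y Y) hL.le
      linarith
    linarith
  have hF2 : ∀ x y, |F x - F y| ≤ L * dist x y := by
    intro x y
    rw [abs_le]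
    have := hF1 y x
    rw [dist_comm] at this
    exact ⟨by linarith, hF1 x y⟩
  obtain ⟨g, hg1, hg2, hg3⟩ := aux_mollify F L hL.le hF2 (Cf * w t) (by positivity)
  refine ⟨g, hg1, hg2, fun x hx => ?_⟩
  have h1 : F x ≤ f x + L * dist x x := ciInf_le (hbdd x) ⟨x, hx⟩
  have h2 : f x - Cf * w t ≤ F x := le_ciInf fun Y => key x hx Y Y.2
  rw [dist_self] at h1
  have h3 := abs_le.1 (hg3 x)
  have : 0 < Cf * w t := by positivity
  rw [abs_le]
  constructor <;> linarith

/-- Lemma 4.1 of the paper: extension of a `C^ω` function `f` from a compact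
set `K` with connected complement to a continuous, compactly supported function `f₀` on
`ℝ^m`, smooth off `K`, with modulus of continuity `c ω` and gradient bound
`|∇ f₀(X)| ≤ c ω(d(X))/d(X)` off `K`. -/
theorem extension_of_Comega_function {m : ℕ} (hm : 3 ≤ m)
    (K : Set (EuclideanSpace ℝ (Fin m))) (hK : IsCompact K) (hKc : IsConnected Kᶜ)
    (ω : ℝ → ℝ) (hω : IsContinuityModulus ω)
    (f : EuclideanSpace ℝ (Fin m) → ℝ)
    (Cf : ℝ) (hCf : 0 < Cf)
    (hf : ∀ X ∈ K, ∀ Y ∈ K, X ≠ Y → |f X - f Y| ≤ Cf * ω (dist X Y)) :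
    ∃ (c : ℝ) (f₀ : EuclideanSpace ℝ (Fin m) → ℝ), 0 < c ∧
      Continuous f₀ ∧ HasCompactSupport f₀ ∧
      ContDiffOn ℝ (⊤ : ℕ∞) f₀ Kᶜ ∧
      (∀ X ∈ K, f₀ X = f X) ∧
      (∀ X₁ X₂ : EuclideanSpace ℝ (Fin m), X₁ ≠ X₂ →
        |f₀ X₁ - f₀ X₂| ≤ c * ω (dist X₁ X₂)) ∧
      (∀ X : EuclideanSpace ℝ (Fin m), X ∉ K →
        ‖fderiv ℝ f₀ X‖ ≤ c * ω (Metric.infDist X K) / Metric.infDist X K) := by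
  obtain ⟨hpos, hmono, -, hlim, hrat⟩ := hω
  rcases K.eq_empty_or_nonempty with rfl | hne
  · refine ⟨1, fun _ => 0, one_pos, continuous_const, ?_, contDiffOn_const, by simp, ?_, by simp⟩
    · exact HasCompactSupport.zero
    · intro X₁ X₂ h
      simpa using (hpos _ (dist_pos.2 h)).le
  have hKcl : IsClosed K := hK.isClosed
  -- doubling
  have hdoub : ∀ l t : ℝ, 1 ≤ l → 0 < t → ω (l * t) ≤ l * ω t := by
    intro l t hl ht
    have h1 : t ≤ l * t := by nlinarith
    have h2 := hrat t (l * t) ht h1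
    have h3 : 0 < l * t := by positivity
    rw [div_le_div_iff₀ h3 ht] at h2
    have : ω (l * t) * t ≤ (l * ω t) * t := by linarith
    exact le_of_mul_le_mul_right this ht
  -- bound on f
  obtain ⟨M, hM0, hM⟩ : ∃ M : ℝ, 0 ≤ M ∧ ∀ Y ∈ K, |f Y| ≤ M := by
    obtain ⟨Y0, hY0⟩ := hne
    obtain ⟨R, hR⟩ := hK.isBounded.subset_closedBall Y0
    have hR1 : (0:ℝ) < max R 1 := by positivity
    have hw := hpos _ hR1
    refine ⟨|f Y0| + Cf * ω (max R 1), by positivity, fun Y hY => ?_⟩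
    rcases eq_or_ne Y Y0 with rfl | hYY
    · have : 0 < Cf * ω (max R 1) := by positivity
      linarith
    have h1 := hf Y hY Y0 hY0 hYY
    have h2 : dist Y Y0 ≤ max R 1 := le_trans (hR hY) (le_max_left _ _)
    have h3 := mul_le_mul_of_nonneg_left (hmono _ _ (dist_pos.2 hYY) h2) hCf.le
    have h4 := abs_sub_abs_le_abs_sub (f Y) (f Y0)
    linarith
  have hw1 := hpos 1 one_pos
  obtain ⟨A, hA, hACf, hAM⟩ : ∃ A : ℝ, 0 < A ∧ 2 * Cf ≤ A ∧ M ≤ A * ω 1 := by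
    refine ⟨2 * Cf + M / ω 1, by positivity, by
      have : 0 ≤ M / ω 1 := by positivity
      linarith, ?_⟩
    have : M / ω 1 * ω 1 = M := by field_simp
    nlinarith
  let t : ℕ → ℝ := fun k => (1 / 2 : ℝ) ^ k
  have htpos : ∀ k, 0 < t k := fun k => by simp only [t]; positivity
  have ht0 : t 0 = 1 := by simp [t]
  have htsucc : ∀ k, t (k + 1) = t k / 2 := fun k => by simp only [t]; rw [pow_succ]; ring
  have htanti : ∀ i j, i ≤ j → t j ≤ t i := fun i j h =>
    pow_le_pow_of_le_one (by norm_num) (by norm_num) h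
  have hexF : ∀ k, ∃ g : EuclideanSpace ℝ (Fin m) → ℝ, ContDiff ℝ (⊤ : ℕ∞) g ∧
      (∀ x y, |g x - g y| ≤ A * (ω (t k) / t k) * dist x y) ∧
      (∀ x ∈ K, |g x - f x| ≤ A * ω (t k)) ∧ (k = 0 → ∀ x, g x = 0) := by
    intro k
    rcases Nat.eq_zero_or_pos k with rfl | hk
    · refine ⟨fun _ => 0, contDiff_const, ?_, ?_, fun _ _ => rfl⟩
      · intro x y
        have := hpos _ (htpos 0)
        have := htpos 0
        simp only [sub_self, abs_zero]
        positivity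
      · intro x hx
        rw [ht0]
        simpa using (hM x hx).trans hAM
    · obtain ⟨g, h1, h2, h3⟩ := aux_approx K hne ω f Cf hCf hpos hmono hrat hf (t k) (htpos k)
      have hw := hpos _ (htpos k)
      have htk := htpos k
      refine ⟨g, h1, fun x y => (h2 x y).trans ?_, fun x hx => (h3 x hx).trans ?_, fun h => by omega⟩
      · rw [mul_div_assoc]
        gcongr
        linarith
      · gcongr
  choose F hFs hFl hFf hF0 using hexF
  obtain ⟨B, hB0, hB⟩ := aux_theta K
  have hexθ := fun k => hB (t k) (htpos k)
  choose θ hθs hθl hθ0 hθ1 hθone hθzero using hexθ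
  classical
  let f₀ : EuclideanSpace ℝ (Fin m) → ℝ := fun x =>
    if x ∈ K then f x else ∑' k, θ k x * (F (k + 1) x - F k x)
  have hfK : ∀ x ∈ K, f₀ x = f x := fun x hx => by simp [f₀, hx]
  have hrep : ∀ x, x ∉ K → ∀ j, 15 / 16 * t j < infDist x K → infDist x K < 9 / 4 * t j →
      f₀ x = F j x + θ j x * (F (j + 1) x - F j x) := by
    intro x hx j h1 h2
    simp only [f₀, hx, if_false]
    rw [tsum_eq_sum (s := Finset.range (j + 1)), Finset.sum_range_succ]
    · congr 1
      have : ∀ k ∈ Finset.range j, θ k x * (F (k + 1) x - F k x) = F (k + 1) x - F k x := by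
        intro k hk
        rw [hθone k x, one_mul]
        have h3 := htanti (k + 1) j (Finset.mem_range.1 hk)
        rw [htsucc] at h3
        linarith
      rw [Finset.sum_congr rfl this, Finset.sum_range_sub (fun k => F k x), hF0 0 rfl x, sub_zero]
    · intro k hk
      rw [hθzero k x, zero_mul]
      have h3 := htanti (j + 1) k (by simpa using hk)
      rw [htsucc] at h3
      linarith
  have hzero : ∀ x, x ∉ K → 15 / 8 < infDist x K → f₀ x = 0 := by
    intro x hx h1
    simp only [f₀, hx, if_false]
    have : ∀ k, θ k x * (F (k + 1) x - F k x) = 0 := by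
      intro k
      rw [hθzero k x, zero_mul]
      have h3 := htanti 0 k (Nat.zero_le _)
      rw [ht0] at h3
      linarith
    simp [this]
  have hdpos : ∀ x, x ∉ K → 0 < infDist x K := fun x hx =>
    (hKcl.notMem_iff_infDist_pos hne).1 hx
  have hdc : Continuous fun x => infDist x K := continuous_infDist_pt K
  -- choice of scale
  have hscale : ∀ x, x ∉ K → infDist x K ≤ 2 → ∃ j, t j < infDist x K ∧ infDist x K ≤ 2 * t j := by
    intro x hx h2
    have h0 := hdpos x hx
    obtain ⟨n, h3, h4⟩ := exists_nat_pow_near_of_lt_one (x := infDist x K / 2) (y := (1 / 2 : ℝ))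
      (by positivity) (by linarith) (by norm_num) (by norm_num)
    refine ⟨n, ?_, ?_⟩
    · rw [pow_succ] at h3
      simp only [t]; linarith
    · simp only [t]; linarith
  have hev : ∀ x, x ∉ K → ∀ j, t j < infDist x K → infDist x K ≤ 2 * t j →
      f₀ =ᶠ[nhds x] fun y => F j y + θ j y * (F (j + 1) y - F j y) := by
    intro x hx j h1 h2
    have hj := htpos j
    have e1 : ∀ᶠ y in nhds x, 15 / 16 * t j < infDist y K :=
      hdc.continuousAt.eventually_const_lt (by linarith)
    have e2 : ∀ᶠ y in nhds x, infDist y K < 9 / 4 * t j :=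
      hdc.continuousAt.eventually_lt_const (by linarith)
    filter_upwards [e1, e2, hKcl.isOpen_compl.mem_nhds hx] with y h3 h4 h5
    exact hrep y h5 j h3 h4
  have hevz : ∀ x, x ∉ K → 2 < infDist x K → f₀ =ᶠ[nhds x] fun _ => 0 := by
    intro x hx h1
    have e1 : ∀ᶠ y in nhds x, 15 / 8 < infDist y K :=
      hdc.continuousAt.eventually_const_lt (by linarith)
    filter_upwards [e1, hKcl.isOpen_compl.mem_nhds hx] with y h3 h5
    exact hzero y h5 h3
  have hsm : ∀ x, x ∉ K → ContDiffAt ℝ (⊤ : ℕ∞) f₀ x := by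
    intro x hx
    rcases le_or_gt (infDist x K) 2 with h | h
    · obtain ⟨j, h1, h2⟩ := hscale x hx h
      refine ContDiffAt.congr_of_eventuallyEq ?_ (hev x hx j h1 h2)
      exact ((hFs j).add ((hθs j).mul ((hFs (j + 1)).sub (hFs j)))).contDiffAt
    · exact contDiffAt_const.congr_of_eventuallyEq (hevz x hx h)
  have hwj : ∀ j, ω (t (j + 1)) ≤ ω (t j) := fun j =>
    hmono _ _ (htpos _) (htanti _ _ (Nat.le_succ j))
  -- approximation of values
  have hval : ∀ x j Y, Y ∈ K → dist x Y ≤ 2 * t j →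
      |F j x - f Y| ≤ 5 * A * ω (t j) ∧ |F (j + 1) x - f Y| ≤ 5 * A * ω (t j) := by
    intro x j Y hY hd
    have hj := htpos j
    have hw := hpos _ hj
    have hw' := hpos _ (htpos (j + 1))
    constructor
    · have h1 := hFl j x Y
      have h2 := hFf j Y hY
      have h3 := abs_add_le (F j x - F j Y) (F j Y - f Y)
      have h4 : A * (ω (t j) / t j) * dist x Y ≤ A * (ω (t j) / t j) * (2 * t j) := by gcongr
      have h5 : A * (ω (t j) / t j) * (2 * t j) = 2 * (A * ω (t j)) := by field_simp
      have h6 : 0 < A * ω (t j) := by positivity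
      rw [sub_add_sub_cancel] at h3
      linarith
    · have h1 := hFl (j + 1) x Y
      have h2 := hFf (j + 1) Y hY
      have h3 := abs_add_le (F (j + 1) x - F (j + 1) Y) (F (j + 1) Y - f Y)
      rw [htsucc] at hw' h1 h2
      have h7 := hwj j
      rw [htsucc] at h7
      have h4 : A * (ω (t j / 2) / (t j / 2)) * dist x Y
          ≤ A * (ω (t j / 2) / (t j / 2)) * (2 * t j) := by gcongr
      have h5 : A * (ω (t j / 2) / (t j / 2)) * (2 * t j) = 4 * (A * ω (t j / 2)) := by
        field_simp; norm_num
      have h6 : A * ω (t j / 2) ≤ A * ω (t j) := by gcongr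
      rw [sub_add_sub_cancel] at h3
      linarith
  have hclose : ∀ x, x ∉ K → ∀ Y ∈ K, infDist x K = dist x Y →
      |f₀ x - f Y| ≤ 5 * A * ω (infDist x K) := by
    intro x hx Y hY hd
    have hd0 := hdpos x hx
    rcases le_or_gt (infDist x K) 2 with h | h
    · obtain ⟨j, h1, h2⟩ := hscale x hx h
      have hj := htpos j
      rw [hrep x hx j (by linarith) (by linarith)]
      obtain ⟨h3, h4⟩ := hval x j Y hY (hd ▸ h2)
      have h5 : 5 * A * ω (t j) ≤ 5 * A * ω (infDist x K) := by
        gcongr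
        exact hmono _ _ hj h1.le
      refine le_trans ?_ h5
      have e : F j x + θ j x * (F (j + 1) x - F j x) - f Y
          = (1 - θ j x) * (F j x - f Y) + θ j x * (F (j + 1) x - f Y) := by ring
      rw [e]
      rw [abs_le] at *
      have a := hθ0 j x
      have b := hθ1 j x
      constructor <;> nlinarith
    · rw [(hevz x hx h).eq_of_nhds]
      have h1 := hM Y hY
      have h2 := hmono 1 _ one_pos (by linarith : 1 ≤ infDist x K)
      have h3 : A * ω 1 ≤ A * ω (infDist x K) := by gcongr
      have h4 : 0 < A * ω 1 := by positivity
      simp only [zero_sub, abs_neg]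
      linarith
  let c1 : ℝ := 2 * (4 + 10 * B) * A
  have hc1 : 0 < c1 := by simp only [c1]; positivity
  have hgrad : ∀ x, x ∉ K → ‖fderiv ℝ f₀ x‖ ≤ c1 * (ω (infDist x K) / infDist x K) := by
    intro x hx
    have hd0 := hdpos x hx
    have hwd := hpos _ hd0
    rcases le_or_gt (infDist x K) 2 with h | h
    · obtain ⟨j, h1, h2⟩ := hscale x hx h
      have hj := htpos j
      have hw := hpos _ hj
      obtain ⟨Y, hY, hYd⟩ := hK.exists_infDist_eq_dist hne x
      obtain ⟨h3, h4⟩ := hval x j Y hY (hYd ▸ h2)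
      have hG : |F (j + 1) x - F j x| ≤ 10 * A * ω (t j) := by
        rw [abs_le] at *
        constructor <;> linarith
      have hq : ω (t j) / t j ≤ 2 * (ω (infDist x K) / infDist x K) := by
        have := hmono _ _ hj h1.le
        calc ω (t j) / t j ≤ ω (infDist x K) / (infDist x K / 2) := by
              gcongr; linarith
          _ = _ := by field_simp
      have hfin : (4 + 10 * B) * A * (ω (t j) / t j) ≤ c1 * (ω (infDist x K) / infDist x K) := by
        calc _ ≤ (4 + 10 * B) * A * (2 * (ω (infDist x K) / infDist x K)) := by gcongr
          _ = _ := by simp only [c1]; ring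
      refine le_trans ?_ hfin
      rw [(hev x hx j h1 h2).fderiv_eq]
      refine norm_fderiv_le_of_lip' ℝ (by positivity) (.of_forall fun y => ?_)
      have l1 := hFl j y x
      have l2 := hFl (j + 1) y x
      have l3 := hθl j y x
      rw [htsucc] at l2
      have hw2 := hwj j
      rw [htsucc] at hw2
      have e1 : A * (ω (t j / 2) / (t j / 2)) * dist y x ≤ 2 * (A * (ω (t j) / t j) * dist y x) := by
        calc _ = 2 * (A * (ω (t j / 2) / t j) * dist y x) := by field_simp
          _ ≤ _ := by gcongr
      have e2 : F j y + θ j y * (F (j + 1) y - F j y) - (F j x + θ j x * (F (j + 1) x - F j x))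
          = (F j y - F j x) + θ j y * ((F (j + 1) y - F (j + 1) x) - (F j y - F j x))
            + (θ j y - θ j x) * (F (j + 1) x - F j x) := by ring
      rw [e2, Real.norm_eq_abs, ← dist_eq_norm]
      set D := A * (ω (t j) / t j) * dist y x with hD
      have i1 : |(F (j + 1) y - F (j + 1) x) - (F j y - F j x)| ≤ 3 * D := by
        rw [abs_le] at *
        constructor <;> linarith
      have i2 : |θ j y * ((F (j + 1) y - F (j + 1) x) - (F j y - F j x))| ≤ 3 * D := by
        rw [abs_mul, abs_of_nonneg (hθ0 j y)]
        have := mul_le_mul (hθ1 j y) i1 (abs_nonneg _) zero_le_one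
        linarith
      have i3 : |(θ j y - θ j x) * (F (j + 1) x - F j x)| ≤ 10 * B * D := by
        rw [abs_mul]
        calc _ ≤ (B / t j * dist y x) * (10 * A * ω (t j)) := by gcongr
          _ = _ := by rw [hD]; ring
      have k1 := abs_add_le ((F j y - F j x) +
        θ j y * ((F (j + 1) y - F (j + 1) x) - (F j y - F j x)))
        ((θ j y - θ j x) * (F (j + 1) x - F j x))
      have k2 := abs_add_le (F j y - F j x)
        (θ j y * ((F (j + 1) y - F (j + 1) x) - (F j y - F j x)))
      have k3 : (4 + 10 * B) * A * (ω (t j) / t j) * dist y x = 4 * D + 10 * B * D := by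
        rw [hD]; ring
      rw [k3]
      linarith
    · rw [(hevz x hx h).fderiv_eq]
      simp only [fderiv_fun_const, Pi.zero_apply, norm_zero]
      positivity
  let c : ℝ := c1 + 20 * A + 5 * Cf
  have hc : 0 < c := by simp only [c]; positivity
  have hc1c : c1 ≤ c := by simp only [c]; linarith
  -- the far case
  have hfar : ∀ X₁ X₂, X₁ ≠ X₂ → 2 * dist X₁ X₂ < infDist X₁ K →
      |f₀ X₁ - f₀ X₂| ≤ c1 * ω (dist X₁ X₂) := by
    intro X₁ X₂ hX hr
    set r := dist X₁ X₂ with hrdef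
    have hr0 : 0 < r := dist_pos.2 hX
    have hin : ∀ y ∈ closedBall X₁ r, r < infDist y K ∧ y ∉ K := by
      intro y hy
      have h1 : infDist X₁ K ≤ infDist y K + dist X₁ y := infDist_le_infDist_add_dist
      have h2 : dist X₁ y ≤ r := by rw [dist_comm]; exact hy
      have h3 : r < infDist y K := by linarith
      refine ⟨h3, fun hyK => ?_⟩
      rw [infDist_zero_of_mem hyK] at h3
      linarith
    have := Convex.norm_image_sub_le_of_norm_fderiv_le (𝕜 := ℝ) (f := f₀) (s := closedBall X₁ r)
      (C := c1 * (ω r / r)) (x := X₂) (y := X₁)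
      (fun y hy => (hsm y (hin y hy).2).differentiableAt (by simp))
      (fun y hy => (hgrad y (hin y hy).2).trans 
        (mul_le_mul_of_nonneg_left (hrat _ _ hr0 (hin y hy).1.le) hc1.le))
      (convex_closedBall _ _) (by rw [mem_closedBall, dist_comm])
      (mem_closedBall_self hr0.le)
    rw [← dist_eq_norm, ← dist_eq_norm, ← hrdef, Real.dist_eq] at this
    calc _ ≤ _ := this
      _ = _ := by field_simp
  have hmod : ∀ X₁ X₂, X₁ ≠ X₂ → |f₀ X₁ - f₀ X₂| ≤ c * ω (dist X₁ X₂) := by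
    intro X₁ X₂ hX
    have hr0 : 0 < dist X₁ X₂ := dist_pos.2 hX
    have hw := hpos _ hr0
    have hcc : c1 * ω (dist X₁ X₂) ≤ c * ω (dist X₁ X₂) := by gcongr
    rcases lt_or_ge (2 * dist X₁ X₂) (infDist X₁ K) with h | h
    · exact (hfar X₁ X₂ hX h).trans hcc
    rcases lt_or_ge (2 * dist X₁ X₂) (infDist X₂ K) with h' | h'
    · rw [abs_sub_comm]
      refine le_trans ?_ hcc
      rw [dist_comm] at h' ⊢
      exact hfar X₂ X₁ hX.symm h'
    have hnear : ∀ x, infDist x K ≤ 2 * dist X₁ X₂ → ∃ Y ∈ K, dist x Y ≤ 2 * dist X₁ X₂ ∧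
        |f₀ x - f Y| ≤ 10 * A * ω (dist X₁ X₂) := by
      intro x hx
      by_cases hxK : x ∈ K
      · refine ⟨x, hxK, by simp, ?_⟩
        rw [hfK x hxK, sub_self, abs_zero]
        positivity
      · obtain ⟨Y, hY, hYd⟩ := hK.exists_infDist_eq_dist hne x
        refine ⟨Y, hY, hYd ▸ hx, (hclose x hxK Y hY hYd).trans ?_⟩
        have h1 := hmono _ _ (hdpos x hxK) hx
        have h2 := hdoub 2 _ one_le_two hr0
        calc 5 * A * ω (infDist x K) ≤ 5 * A * (2 * ω (dist X₁ X₂)) := by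
              gcongr; exact h1.trans h2
          _ = _ := by ring
    obtain ⟨Y₁, hY₁, d1, v1⟩ := hnear X₁ h
    obtain ⟨Y₂, hY₂, d2, v2⟩ := hnear X₂ h'
    have v3 : |f Y₁ - f Y₂| ≤ 5 * Cf * ω (dist X₁ X₂) := by
      rcases eq_or_ne Y₁ Y₂ with rfl | hYY
      · rw [sub_self, abs_zero]; positivity
      have h1 : dist Y₁ Y₂ ≤ 5 * dist X₁ X₂ := by
        have := dist_triangle4 Y₁ X₁ X₂ Y₂
        rw [dist_comm Y₁ X₁] at this
        linarith
      have h2 := hmono _ _ (dist_pos.2 hYY) h1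
      have h3 := hdoub 5 _ (by norm_num) hr0
      calc _ ≤ Cf * ω (dist Y₁ Y₂) := hf Y₁ hY₁ Y₂ hY₂ hYY
        _ ≤ Cf * (5 * ω (dist X₁ X₂)) := by gcongr; exact h2.trans h3
        _ = _ := by ring
    have e : c * ω (dist X₁ X₂) = c1 * ω (dist X₁ X₂) + 2 * (10 * A * ω (dist X₁ X₂))
        + 5 * Cf * ω (dist X₁ X₂) := by simp only [c]; ring
    have : 0 < c1 * ω (dist X₁ X₂) := by positivity
    rw [e]
    rw [abs_le] at *
    constructor <;> linarith
  refine ⟨c, f₀, hc, ?_, ?_, ?_, hfK, hmod, ?_⟩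
  · rw [continuous_iff_continuousAt]
    intro x
    rw [Metric.continuousAt_iff]
    intro ε hε
    have h1 : ∀ᶠ s in nhdsWithin 0 (Set.Ioi (0:ℝ)), ω s < ε / c :=
      hlim.eventually_lt_const (by positivity)
    rw [eventually_nhdsWithin_iff, Metric.eventually_nhds_iff] at h1
    obtain ⟨δ, hδ, h2⟩ := h1
    refine ⟨δ, hδ, fun y hy => ?_⟩
    rcases eq_or_ne y x with rfl | hyx
    · simpa using hε
    have h3 := h2 (y := dist y x) (by simpa using hy) (dist_pos.2 hyx)
    rw [Real.dist_eq]
    calc _ ≤ c * ω (dist y x) := hmod y x hyx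
      _ < c * (ε / c) := by gcongr
      _ = ε := by field_simp
  · refine HasCompactSupport.intro (hK.cthickening (r := 2)) fun x hx => ?_
    have h2 : 2 < infDist x K := by
      by_contra hcon
      apply hx
      obtain ⟨Y, hY, hYd⟩ := hK.exists_infDist_eq_dist hne x
      exact mem_cthickening_of_dist_le x Y 2 K hY (by linarith)
    have hxK : x ∉ K := fun hxK => by
      rw [infDist_zero_of_mem hxK] at h2; linarith
    exact (hevz x hxK h2).eq_of_nhds
  · exact fun x hx => (hsm x hx).contDiffWithinAt
  · intro X hX
    have hd0 := hdpos X hX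
    have hwd := hpos _ hd0
    rw [mul_div_assoc]
    refine (hgrad X hX).trans ?_
    gcongr
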